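/- Let G be a connected graph with edge lengths ℓ and let V_D ⊆ V be nonempty with every vertex in V_D of degree one. Suppose ω₀ > 0 is the smallest positive zero of ω ↦ det A_ω(G, V_D), i.e. det A_{ω₀}(G, V_D) = 0 and det A_ω(G, V_D) ≠ 0 for 0 < ω < ω₀. Let a > 0 and for each ω ≥ a let P_ω be a real square matrix of size |V| + 2|E| such that every entry of the map ω ↦ P_ω is a bounded, infinitely differentiable function on [a,∞) all of whose derivatives are bounded on [a,∞). Define B_ω := A_ω(G, V_D) + ω^{−1} P_ω for ω ≥ a. Then there exists a strictly increasing sequence (ω_n) in [a,∞) with ω_n → ∞ such that det B_{ω_n} = 0 for all n and B_{ω_n} → A_{ω₀}(G, V_D) (entrywise, equivalently in Frobenius norm) as n → ∞. -/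

import Mathlib

open Matrix Filter Topology

attribute [local instance] Classical.propDecidable

/-- The secular matrix built from per-edge cosine values `c` and sine values `s`,
for a graph with initial/terminal vertex maps `ι`, `τ` and Dirichlet vertex set `VD`.
Rows and columns are indexed by `V ⊕ E × Bool`, where `(e, false)` plays the role of
`(e,0)` (initial endpoint data) and `(e, true)` of `(e,1)` (terminal endpoint data). -/
noncomputable def secMatrix {V E : Type} (ι τ : E → V) (VD : Set V)
    (c s : E → ℝ) : Matrix (V ⊕ E × Bool) (V ⊕ E × Bool) ℝ :=
  Matrix.of fun i j =>
    match i, j with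
    | Sum.inl v, Sum.inl u =>
        if v ∈ VD then (if u = v then (1 : ℝ) else 0) else 0
    | Sum.inl v, Sum.inr (f, b) =>
        if v ∈ VD then 0
        else if b then (if τ f = v then 1 else 0) else (if ι f = v then 1 else 0)
    | Sum.inr (e, b), Sum.inl u =>
        if b then (if u = ι e then s e else 0)
        else (if u = τ e then 1 else 0) + (if u = ι e then -(c e) else 0)
    | Sum.inr (e, b), Sum.inr (f, b') =>
        if b then
          (if f = e ∧ b' = false then c e else 0) + (if f = e ∧ b' = true then 1 else 0)
        else if f = e ∧ b' = false then s e else 0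

/-- The secular matrix `A_ω(G, V_D)` of a metric graph with edge lengths `ℓ`. -/
noncomputable def secA {V E : Type} (ι τ : E → V) (VD : Set V) (ℓ : E → ℝ) (ω : ℝ) :
    Matrix (V ⊕ E × Bool) (V ⊕ E × Bool) ℝ :=
  secMatrix ι τ VD (fun e => Real.cos (ℓ e * ω)) (fun e => Real.sin (ℓ e * ω))

/-- Two vertices are adjacent if some edge joins them (in either direction). -/
def GraphAdj {V E : Type} (ι τ : E → V) (u w : V) : Prop :=
  ∃ e : E, (ι e = u ∧ τ e = w) ∨ (ι e = w ∧ τ e = u)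

/-- A graph is connected if any two vertices are joined by a walk. -/
def IsConnectedGraph {V E : Type} (ι τ : E → V) : Prop :=
  ∀ u w : V, Relation.ReflTransGen (GraphAdj ι τ) u w

/-- The degree of a vertex: the number of edges incident to it. -/
noncomputable def graphDegree {V E : Type} [Fintype E] (ι τ : E → V) (v : V) : ℕ :=
  (Finset.univ.filter fun e => ι e = v ∨ τ e = v).card

section SecularMatrix

variable {V E : Type} {ι τ : E → V} {ℓ : E → ℝ}

section Rows

variable [Fintype V] [Fintype E] {VD : Set V}

lemma secA_mulVec_inl (ω : ℝ) (z : V ⊕ E × Bool → ℝ) (v : V) :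
    (secA ι τ VD ℓ ω *ᵥ z) (Sum.inl v) =
      if v ∈ VD then z (Sum.inl v) else
        ∑ e, ((if ι e = v then z (Sum.inr (e, false)) else 0) +
          (if τ e = v then z (Sum.inr (e, true)) else 0)) := by
  by_cases h : v ∈ VD
  · simp [Matrix.mulVec, dotProduct, secA, secMatrix, h, Fintype.sum_sum_type]
  · simp [Matrix.mulVec, dotProduct, secA, secMatrix, h, Fintype.sum_sum_type,
      Fintype.sum_prod_type, add_comm]

lemma secA_mulVec_inr_false (ω : ℝ) (z : V ⊕ E × Bool → ℝ) (e : E) :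
    (secA ι τ VD ℓ ω *ᵥ z) (Sum.inr (e, false)) =
      z (Sum.inl (τ e)) - Real.cos (ℓ e * ω) * z (Sum.inl (ι e))
        + Real.sin (ℓ e * ω) * z (Sum.inr (e, false)) := by
  simp [Matrix.mulVec, dotProduct, secA, secMatrix, Fintype.sum_sum_type,
      Fintype.sum_prod_type, add_mul, Finset.sum_add_distrib]
  ring

lemma secA_mulVec_inr_true (ω : ℝ) (z : V ⊕ E × Bool → ℝ) (e : E) :
    (secA ι τ VD ℓ ω *ᵥ z) (Sum.inr (e, true)) =
      Real.sin (ℓ e * ω) * z (Sum.inl (ι e))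
        + Real.cos (ℓ e * ω) * z (Sum.inr (e, false)) + z (Sum.inr (e, true)) := by
  simp [Matrix.mulVec, dotProduct, secA, secMatrix, Fintype.sum_sum_type,
      Fintype.sum_prod_type, Finset.sum_add_distrib]
  ring

end Rows


lemma sin_pos_of_length (hℓ : ∀ e, 0 < ℓ e) {ω : ℝ} (h0 : 0 < ω) (hπ : ∀ e, ℓ e * ω < Real.pi)
    (e : E) : 0 < Real.sin (ℓ e * ω) :=
  Real.sin_pos_of_pos_of_lt_pi (mul_pos (hℓ e) h0) (hπ e)

section EdgeForm

variable [Fintype E]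

variable (ι τ ℓ) in
/-- The Dirichlet-to-Neumann quadratic form of the graph at frequency `ω`. -/
noncomputable def edgeForm (ω : ℝ) (x : V → ℝ) : ℝ :=
  ∑ e, (Real.cos (ℓ e * ω) * (x (ι e) ^ 2 + x (τ e) ^ 2) - 2 * x (ι e) * x (τ e))
    / Real.sin (ℓ e * ω)

variable (ι τ ℓ) in
/-- The total flux at a vertex of the solution with vertex values `x` at frequency `ω`. -/
noncomputable def vertexFlux (ω : ℝ) (x : V → ℝ) (v : V) : ℝ :=
  ∑ e, ((if ι e = v then (Real.cos (ℓ e * ω) * x (ι e) - x (τ e)) / Real.sin (ℓ e * ω) else 0) +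
    (if τ e = v then (Real.cos (ℓ e * ω) * x (τ e) - x (ι e)) / Real.sin (ℓ e * ω) else 0))

variable (ι τ ℓ) in
/-- Positivity of the form on nonzero vectors vanishing on `W`. -/
def FormPos (W : Set V) (ω : ℝ) : Prop :=
  ∀ x : V → ℝ, (∀ v ∈ W, x v = 0) → x ≠ 0 → 0 < edgeForm ι τ ℓ ω x

lemma FormPos.mono {W W' : Set V} {ω : ℝ} (h : FormPos ι τ ℓ W ω) (hW : W ⊆ W') :
    FormPos ι τ ℓ W' ω :=
  fun x hx hx0 => h x (fun v hv => hx v (hW hv)) hx0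

lemma FormPos.nonneg {W : Set V} {ω : ℝ} (h : FormPos ι τ ℓ W ω) {x : V → ℝ}
    (hx : ∀ v ∈ W, x v = 0) : 0 ≤ edgeForm ι τ ℓ ω x := by
  by_cases hx0 : x = 0
  · simp [hx0, edgeForm]
  · exact (h x hx hx0).le

lemma edgeForm_smul (ω c : ℝ) (x : V → ℝ) :
    edgeForm ι τ ℓ ω (c • x) = c ^ 2 * edgeForm ι τ ℓ ω x := by
  simp only [edgeForm, Finset.mul_sum, Pi.smul_apply, smul_eq_mul]
  refine Finset.sum_congr rfl fun e _ => ?_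
  ring

lemma sum_mul_incidence_sum [Fintype V] (h : V → ℝ) (p q : E → ℝ) :
    ∑ v, h v * ∑ e, ((if ι e = v then p e else 0) + (if τ e = v then q e else 0)) =
      ∑ e, (h (ι e) * p e + h (τ e) * q e) := by
  simp only [Finset.mul_sum]
  rw [Finset.sum_comm]
  refine Finset.sum_congr rfl fun e _ => ?_
  simp [mul_add, Finset.sum_add_distrib]

lemma edgeForm_eq_sum_flux [Fintype V] (ω : ℝ) (x : V → ℝ) :
    edgeForm ι τ ℓ ω x = ∑ v, x v * vertexFlux ι τ ℓ ω x v := by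
  simp only [vertexFlux]
  rw [sum_mul_incidence_sum, edgeForm]
  refine Finset.sum_congr rfl fun e _ => ?_
  ring

lemma edgeForm_add [Fintype V] (ω : ℝ) (x h : V → ℝ) :
    edgeForm ι τ ℓ ω (x + h) =
      edgeForm ι τ ℓ ω x + 2 * ∑ v, h v * vertexFlux ι τ ℓ ω x v + edgeForm ι τ ℓ ω h := by
  simp only [vertexFlux]
  rw [sum_mul_incidence_sum, edgeForm, edgeForm, edgeForm, Finset.mul_sum,
    ← Finset.sum_add_distrib, ← Finset.sum_add_distrib]
  refine Finset.sum_congr rfl fun e _ => ?_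
  simp only [Pi.add_apply]
  ring

/-- A minimiser of a nonnegative form has vanishing flux away from the constraint set. -/
lemma vertexFlux_eq_zero [Fintype V] {W : Set V} {ω : ℝ}
    (hnn : ∀ x : V → ℝ, (∀ v ∈ W, x v = 0) → 0 ≤ edgeForm ι τ ℓ ω x)
    {x : V → ℝ} (hx : ∀ v ∈ W, x v = 0) (hq : edgeForm ι τ ℓ ω x = 0) {v : V} (hv : v ∉ W) :
    vertexFlux ι τ ℓ ω x v = 0 := by
  set δ : V → ℝ := Pi.single v 1 with hδ
  have hδW : ∀ u ∈ W, δ u = 0 := fun u hu => by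
    rw [hδ, Pi.single_apply, if_neg]
    rintro rfl
    exact hv hu
  have key : ∀ t : ℝ, 0 ≤ 2 * t * vertexFlux ι τ ℓ ω x v + t ^ 2 * edgeForm ι τ ℓ ω δ := by
    intro t
    have h1 := hnn (x + t • δ) fun u hu => by simp [hx u hu, hδW u hu]
    rw [edgeForm_add, hq, edgeForm_smul] at h1
    have h2 : ∑ u, (t • δ) u * vertexFlux ι τ ℓ ω x u = t * vertexFlux ι τ ℓ ω x v := by
      simp [hδ, Pi.single_apply]
    rw [h2] at h1
    linarith
  have hδ0 := hnn δ hδW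
  set g := vertexFlux ι τ ℓ ω x v
  set c := edgeForm ι τ ℓ ω δ
  have h3 := key (-g / (c + 1))
  have hc : 0 < c + 1 := by linarith
  have h4 : 2 * (-g / (c + 1)) * g + (-g / (c + 1)) ^ 2 * c =
      -(g ^ 2 * (c + 2) / (c + 1) ^ 2) := by
    field_simp
    ring
  rw [h4] at h3
  by_contra hg
  have : 0 < g ^ 2 * (c + 2) / (c + 1) ^ 2 := by positivity
  linarith

lemma edgeForm_abs_le {ω : ℝ} (hs : ∀ e, 0 < Real.sin (ℓ e * ω)) (x : V → ℝ) :
    edgeForm ι τ ℓ ω |x| ≤ edgeForm ι τ ℓ ω x := by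
  refine Finset.sum_le_sum fun e _ => ?_
  refine div_le_div_of_nonneg_right ?_ (hs e).le
  simp only [Pi.abs_apply, sq_abs]
  have := le_abs_self (x (ι e) * x (τ e))
  rw [abs_mul] at this
  nlinarith

lemma sin_diff_bounds {θ θ' : ℝ} (h0 : 0 < θ) (h1 : θ < θ') (h2 : θ' < Real.pi) :
    |Real.sin θ' - Real.sin θ| < Real.sin (θ' - θ) := by
  obtain ⟨α, rfl⟩ : ∃ α, θ = 2 * α := ⟨θ / 2, by ring⟩
  obtain ⟨β, rfl⟩ : ∃ β, θ' = 2 * β := ⟨θ' / 2, by ring⟩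
  have hd : 0 < Real.sin (β - α) := Real.sin_pos_of_pos_of_lt_pi (by linarith) (by linarith)
  have hsα : 0 < Real.sin α := Real.sin_pos_of_pos_of_lt_pi (by linarith) (by linarith)
  have hsβ : 0 < Real.sin β := Real.sin_pos_of_pos_of_lt_pi (by linarith) (by linarith)
  have hcα : 0 < Real.cos α := Real.cos_pos_of_mem_Ioo ⟨by linarith, by linarith⟩
  have hcβ : 0 < Real.cos β := Real.cos_pos_of_mem_Ioo ⟨by linarith, by linarith⟩
  have e1 : Real.sin (2 * β) - Real.sin (2 * α) = 2 * Real.sin (β - α) * Real.cos (β + α) := by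
    rw [Real.sin_sub_sin]
    congr 2 <;> ring_nf
  have e2 : Real.sin (2 * β - 2 * α) = 2 * Real.sin (β - α) * Real.cos (β - α) := by
    rw [← Real.sin_two_mul]
    ring_nf
  rw [e1, e2, abs_lt]
  have := Real.cos_add β α
  have := Real.cos_sub β α
  have p1 := mul_pos hd (mul_pos hsα hsβ)
  have p2 := mul_pos hd (mul_pos hcα hcβ)
  constructor <;> nlinarith

lemma edge_term_lt {θ θ' : ℝ} (h0 : 0 < θ) (h1 : θ < θ') (h2 : θ' < Real.pi) {a b : ℝ}
    (hab : a ≠ 0 ∨ b ≠ 0) :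
    (Real.cos θ' * (a ^ 2 + b ^ 2) - 2 * a * b) / Real.sin θ' <
      (Real.cos θ * (a ^ 2 + b ^ 2) - 2 * a * b) / Real.sin θ := by
  have hs : 0 < Real.sin θ := Real.sin_pos_of_pos_of_lt_pi h0 (by linarith)
  have hs' : 0 < Real.sin θ' := Real.sin_pos_of_pos_of_lt_pi (by linarith) h2
  rw [div_lt_div_iff₀ hs' hs]
  obtain ⟨k1, k2⟩ := abs_lt.1 (sin_diff_bounds h0 h1 h2)
  have hsub := Real.sin_sub θ' θ
  have hpos : 0 < a ^ 2 + b ^ 2 := by rcases hab with h | h <;> positivity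
  set S := Real.sin (θ' - θ)
  set K := Real.sin θ' - Real.sin θ with hK
  have hmain : 0 < S * (a ^ 2 + b ^ 2) - 2 * a * b * K := by
    rcases eq_or_ne (a + b) 0 with h | h
    · have hb : b = -a := by linarith
      subst hb
      have : 0 < a ^ 2 := by nlinarith
      nlinarith
    · have := mul_pos (sub_pos.2 k2) (sq_pos_of_ne_zero h)
      have := mul_nonneg (sub_pos.2 k1).le (sq_nonneg (a - b))
      nlinarith
  rw [hsub] at hmain
  rw [hK] at hmain
  linarith

lemma edge_term_le {θ θ' : ℝ} (h0 : 0 < θ) (h1 : θ < θ') (h2 : θ' < Real.pi) (a b : ℝ) :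
    (Real.cos θ' * (a ^ 2 + b ^ 2) - 2 * a * b) / Real.sin θ' ≤
      (Real.cos θ * (a ^ 2 + b ^ 2) - 2 * a * b) / Real.sin θ := by
  by_cases hab : a ≠ 0 ∨ b ≠ 0
  · exact (edge_term_lt h0 h1 h2 hab).le
  · push Not at hab
    simp [hab.1, hab.2]

lemma edgeForm_lt {ω ω' : ℝ} (hℓ : ∀ e, 0 < ℓ e) (h0 : 0 < ω) (h1 : ω < ω')
    (h2 : ∀ e, ℓ e * ω' < Real.pi) {x : V → ℝ} (hx : ∃ e, x (ι e) ≠ 0 ∨ x (τ e) ≠ 0) :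
    edgeForm ι τ ℓ ω' x < edgeForm ι τ ℓ ω x := by
  obtain ⟨e, he⟩ := hx
  exact Finset.sum_lt_sum
    (fun e _ => edge_term_le (mul_pos (hℓ e) h0) (mul_lt_mul_of_pos_left h1 (hℓ e)) (h2 e) _ _)
    ⟨e, Finset.mem_univ e,
      edge_term_lt (mul_pos (hℓ e) h0) (mul_lt_mul_of_pos_left h1 (hℓ e)) (h2 e) he⟩

lemma continuousAt_edgeForm {ω : ℝ} (hs : ∀ e, Real.sin (ℓ e * ω) ≠ 0) (x : V → ℝ) :
    ContinuousAt (fun p : ℝ × (V → ℝ) => edgeForm ι τ ℓ p.1 p.2) (ω, x) := by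
  unfold edgeForm
  refine tendsto_finsetSum _ fun e _ => ?_
  refine ContinuousAt.div ?_ ?_ (hs e) <;> fun_prop

lemma eventually_pos_of_homogeneous [Fintype V] {Q : ℝ → (V → ℝ) → ℝ} {W : Set V} {ω : ℝ}
    (hcont : ∀ x, ContinuousAt (fun p : ℝ × (V → ℝ) => Q p.1 p.2) (ω, x))
    (hom : ∀ t (c : ℝ) x, Q t (c • x) = c ^ 2 * Q t x)
    (hpos : ∀ x : V → ℝ, (∀ v ∈ W, x v = 0) → x ≠ 0 → 0 < Q ω x) :
    ∀ᶠ t in 𝓝 ω, ∀ x : V → ℝ, (∀ v ∈ W, x v = 0) → x ≠ 0 → 0 < Q t x := by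
  set K : Set (V → ℝ) := Metric.sphere 0 1 ∩ {x | ∀ v ∈ W, x v = 0} with hKdef
  have hK : IsCompact K := by
    refine (isCompact_sphere _ _).inter_right ?_
    simp only [Set.ofPred_forall]
    exact isClosed_iInter fun v => isClosed_iInter fun _ =>
      isClosed_eq (continuous_apply v) continuous_const
  have h := hK.eventually_forall_of_forall_eventually (x₀ := ω) (P := fun t x => 0 < Q t x)
    fun x hx => (hcont x).eventually_const_lt <| hpos x hx.2 <| by
      rintro rfl
      simp [hKdef] at hx
  filter_upwards [h] with t ht x hxW hx0
  have hn : 0 < ‖x‖ := norm_pos_iff.2 hx0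
  have h1 := ht (‖x‖⁻¹ • x) ⟨by simp [norm_smul, hn.ne'], fun v hv => by simp [hxW v hv]⟩
  rw [hom] at h1
  exact pos_of_mul_pos_right h1 (by positivity)

lemma FormPos.eventually [Fintype V] {W : Set V} {ω : ℝ} (h : FormPos ι τ ℓ W ω)
    (hs : ∀ e, Real.sin (ℓ e * ω) ≠ 0) : ∀ᶠ t in 𝓝 ω, FormPos ι τ ℓ W t :=
  eventually_pos_of_homogeneous (continuousAt_edgeForm hs) edgeForm_smul h

lemma edgeForm_nonneg_of_mem_closure {s : Set ℝ} {ω : ℝ} (hs : ∀ e, Real.sin (ℓ e * ω) ≠ 0)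
    (hpos : ∀ t ∈ s, FormPos ι τ ℓ W t) (hω : ω ∈ closure s) (x : V → ℝ)
    (hx : ∀ v ∈ W, x v = 0) : 0 ≤ edgeForm ι τ ℓ ω x := by
  have hc : ContinuousAt (fun t => edgeForm ι τ ℓ t x) ω :=
    (continuousAt_edgeForm hs x).comp (f := fun t => (t, x)) (by fun_prop)
  have := mem_closure_iff_nhdsWithin_neBot.1 hω
  refine ge_of_tendsto (hc.mono_left nhdsWithin_le_nhds : Tendsto _ (𝓝[s] ω) _) ?_
  filter_upwards [self_mem_nhdsWithin] with t ht using (hpos t ht).nonneg hx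

end EdgeForm

section Connectivity

lemma eq_of_graphDegree_eq_one [Fintype E] {v : V} (h : graphDegree ι τ v = 1) {e e' : E}
    (he : ι e = v ∨ τ e = v) (he' : ι e' = v ∨ τ e' = v) : e = e' :=
  Finset.card_le_one.1 h.le e (by simpa using he) e' (by simpa using he')

lemma IsConnectedGraph.exists_incident [Fintype E] {VD : Set V} (hconn : IsConnectedGraph ι τ)
    (hVD : VD.Nonempty) (hdeg : ∀ v ∈ VD, graphDegree ι τ v = 1) (u : V) :
    ∃ e, ι e = u ∨ τ e = u := by
  obtain ⟨d, hd⟩ := hVD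
  rcases (hconn u d).cases_head with rfl | ⟨w, ⟨e, he⟩, -⟩
  · have h1 : 0 < graphDegree ι τ u := by simp [hdeg u hd]
    obtain ⟨e, he⟩ := Finset.card_pos.1 h1
    exact ⟨e, by simpa using he⟩
  · exact ⟨e, he.imp And.left And.right⟩

/-- If both ends of an edge are leaves, the graph consists of this edge. -/
lemma IsConnectedGraph.eq_ends [Fintype E] {VD : Set V} (hconn : IsConnectedGraph ι τ)
    (hdeg : ∀ v ∈ VD, graphDegree ι τ v = 1) {e : E} (h1 : ι e ∈ VD) (h2 : τ e ∈ VD) (u : V) :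
    u = ι e ∨ u = τ e := by
  induction hconn (ι e) u with
  | refl => exact Or.inl rfl
  | tail _ hadj ih =>
    obtain ⟨e', he'⟩ := hadj
    have : e' = e := by
      rcases ih with rfl | rfl
      · exact eq_of_graphDegree_eq_one (hdeg _ h1) (he'.imp And.left And.right) (Or.inl rfl)
      · exact eq_of_graphDegree_eq_one (hdeg _ h2) (he'.imp And.left And.right) (Or.inr rfl)
    subst this
    rcases he' with h | h
    · exact Or.inr h.2.symm
    · exact Or.inl h.1.symm

/-- Vanishing that spreads from interior vertices to their neighbours spreads everywhere, since
a leaf is never an intermediate vertex of a path. -/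
lemma IsConnectedGraph.eq_zero_of_spread [Fintype E] {VD : Set V} (hconn : IsConnectedGraph ι τ)
    (hdeg : ∀ v ∈ VD, graphDegree ι τ v = 1) {y : V → ℝ}
    (hspread : ∀ u ∉ VD, y u = 0 → ∀ e, (ι e = u → y (τ e) = 0) ∧ (τ e = u → y (ι e) = 0))
    {v : V} (hv : v ∉ VD) (hyv : y v = 0) : y = 0 := by
  have key : ∀ u, y u = 0 ∧ ∀ e, (ι e = u → y (τ e) = 0) ∧ (τ e = u → y (ι e) = 0) := by
    intro u
    induction hconn v u with
    | refl => exact ⟨hyv, hspread v hv hyv⟩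
    | @tail b c _ hadj ih =>
      obtain ⟨e, he⟩ := hadj
      have hc : y c = 0 := by
        rcases he with ⟨h1, h2⟩ | ⟨h1, h2⟩
        · exact h2 ▸ (ih.2 e).1 h1
        · exact h1 ▸ (ih.2 e).2 h2
      refine ⟨hc, ?_⟩
      by_cases hcD : c ∈ VD
      · intro e'
        have hee : ι e' = c ∨ τ e' = c → e' = e := fun h =>
          eq_of_graphDegree_eq_one (hdeg c hcD) h (he.symm.imp And.left And.right)
        have hends : y (ι e) = 0 ∧ y (τ e) = 0 := by
          rcases he with ⟨h1, h2⟩ | ⟨h1, h2⟩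
          · exact ⟨h1 ▸ ih.1, h2 ▸ hc⟩
          · exact ⟨h1 ▸ hc, h2 ▸ ih.1⟩
        exact ⟨fun h => hee (Or.inl h) ▸ hends.2, fun h => hee (Or.inr h) ▸ hends.1⟩
      · exact hspread c hcD hc
  exact funext fun u => (key u).1

lemma IsConnectedGraph.eq_zero_of_const {VD : Set V} (hconn : IsConnectedGraph ι τ)
    (hVD : VD.Nonempty) {y : V → ℝ} (hy : ∀ v ∈ VD, y v = 0) (hc : ∀ e, y (ι e) = y (τ e)) :
    y = 0 := by
  obtain ⟨d, hd⟩ := hVD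
  funext u
  induction hconn d u with
  | refl => exact hy d hd
  | tail _ hadj ih =>
    obtain ⟨e, ⟨rfl, rfl⟩ | ⟨rfl, rfl⟩⟩ := hadj
    · rw [← hc e, ih, Pi.zero_apply, Pi.zero_apply]
    · rw [hc e, ih, Pi.zero_apply, Pi.zero_apply]

end Connectivity

section Positivity

variable [Fintype V] [Fintype E] {VD : Set V}

lemma edge_term_lower {θ : ℝ} (h0 : 0 < θ) (h1 : θ < Real.pi / 2) (a b : ℝ) :
    Real.cos θ * (a - b) ^ 2 - 2 * a * b * (Real.sin θ / (1 + Real.cos θ)) ≤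
      (Real.cos θ * (a ^ 2 + b ^ 2) - 2 * a * b) / Real.sin θ := by
  have hs : 0 < Real.sin θ := Real.sin_pos_of_pos_of_lt_pi h0 (by linarith)
  have hc : 0 < Real.cos θ := Real.cos_pos_of_mem_Ioo ⟨by linarith, h1⟩
  have hh : Real.sin θ / (1 + Real.cos θ) = (1 - Real.cos θ) / Real.sin θ := by
    rw [div_eq_div_iff (by linarith) hs.ne']
    nlinarith [Real.sin_sq_add_cos_sq θ]
  have h2 : (Real.cos θ * (a ^ 2 + b ^ 2) - 2 * a * b) / Real.sin θ =
      Real.cos θ * (a - b) ^ 2 / Real.sin θ - 2 * a * b * ((1 - Real.cos θ) / Real.sin θ) := by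
    field_simp
    ring
  rw [h2, hh]
  gcongr
  rw [le_div_iff₀ hs]
  have : 0 ≤ Real.cos θ * (a - b) ^ 2 := by positivity
  nlinarith [Real.sin_le_one θ]

lemma FormPos.eventually_zero (hconn : IsConnectedGraph ι τ) (hℓ : ∀ e, 0 < ℓ e)
    (hVD : VD.Nonempty) : ∀ᶠ ω in 𝓝[>] (0 : ℝ), FormPos ι τ ℓ VD ω := by
  set Q : ℝ → (V → ℝ) → ℝ := fun ω x => ∑ e, (Real.cos (ℓ e * ω) * (x (ι e) - x (τ e)) ^ 2 -
    2 * x (ι e) * x (τ e) * (Real.sin (ℓ e * ω) / (1 + Real.cos (ℓ e * ω)))) with hQ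
  have hev : ∀ᶠ t in 𝓝 (0 : ℝ), ∀ x : V → ℝ, (∀ v ∈ VD, x v = 0) → x ≠ 0 → 0 < Q t x := by
    refine eventually_pos_of_homogeneous (fun x => ?_) (fun t c x => ?_) fun x hx hx0 => ?_
    · refine tendsto_finsetSum _ fun e _ => ContinuousAt.sub ?_ (ContinuousAt.mul ?_
        (ContinuousAt.div ?_ ?_ ?_))
      all_goals first | fun_prop | (norm_num)
    · simp only [hQ, Finset.mul_sum, Pi.smul_apply, smul_eq_mul]
      exact Finset.sum_congr rfl fun e _ => by ring
    · have h0 : Q 0 x = ∑ e, (x (ι e) - x (τ e)) ^ 2 := by simp [hQ]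
      rw [h0]
      refine lt_of_le_of_ne (Finset.sum_nonneg fun e _ => sq_nonneg _) fun h => hx0 ?_
      rw [eq_comm, Finset.sum_eq_zero_iff_of_nonneg fun e _ => sq_nonneg _] at h
      exact hconn.eq_zero_of_const hVD hx fun e => by
        simpa [sub_eq_zero] using h e (Finset.mem_univ e)
  have hsmall : ∀ᶠ t in 𝓝 (0 : ℝ), ∀ e, ℓ e * t < Real.pi / 2 := by
    refine eventually_all.2 fun e => ?_
    have : ContinuousAt (fun t : ℝ => ℓ e * t) 0 := by fun_prop
    exact this.eventually_lt_const (by simpa using Real.pi_div_two_pos)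
  filter_upwards [nhdsWithin_le_nhds hev, nhdsWithin_le_nhds hsmall, self_mem_nhdsWithin]
    with t h1 h2 h3 x hx hx0
  exact (h1 x hx hx0).trans_le <| Finset.sum_le_sum fun e _ =>
    edge_term_lower (mul_pos (hℓ e) h3) (h2 e) _ _

section Secular

variable {ω : ℝ}

lemma flux_eq_of_edge_rows (hs : ∀ e, Real.sin (ℓ e * ω) ≠ 0) {z : V ⊕ E × Bool → ℝ}
    (hz : ∀ p, (secA ι τ VD ℓ ω *ᵥ z) (Sum.inr p) = 0) {v : V} (hv : v ∉ VD) :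
    (secA ι τ VD ℓ ω *ᵥ z) (Sum.inl v) = vertexFlux ι τ ℓ ω (fun u => z (Sum.inl u)) v := by
  rw [secA_mulVec_inl, if_neg hv]
  refine Finset.sum_congr rfl fun e _ => ?_
  have h1 := hz (e, false)
  have h2 := hz (e, true)
  rw [secA_mulVec_inr_false] at h1
  rw [secA_mulVec_inr_true] at h2
  have e1 : z (Sum.inr (e, false)) = (Real.cos (ℓ e * ω) * z (Sum.inl (ι e)) - z (Sum.inl (τ e)))
      / Real.sin (ℓ e * ω) := by
    rw [eq_div_iff (hs e)]
    linarith
  have e2 : z (Sum.inr (e, true)) = (Real.cos (ℓ e * ω) * z (Sum.inl (τ e)) - z (Sum.inl (ι e)))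
      / Real.sin (ℓ e * ω) := by
    rw [e1] at h2
    have := hs e
    field_simp at h2 ⊢
    linear_combination h2 - z (Sum.inl (ι e)) * Real.sin_sq_add_cos_sq (ℓ e * ω)
  rw [e1, e2]

lemma eq_zero_of_edge_rows (hs : ∀ e, Real.sin (ℓ e * ω) ≠ 0) {z : V ⊕ E × Bool → ℝ}
    (hz : ∀ p, (secA ι τ VD ℓ ω *ᵥ z) (Sum.inr p) = 0) (hx : (fun u => z (Sum.inl u)) = 0) :
    z = 0 := by
  have hx' : ∀ u, z (Sum.inl u) = 0 := fun u => congrFun hx u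
  have h0 : ∀ e, z (Sum.inr (e, false)) = 0 := fun e => by
    have h1 := hz (e, false)
    rw [secA_mulVec_inr_false] at h1
    simpa [hx', hs e] using h1
  funext i
  rcases i with u | ⟨e, _ | _⟩
  · exact hx' u
  · exact h0 e
  · have h2 := hz (e, true)
    rw [secA_mulVec_inr_true] at h2
    simpa [hx', h0] using h2

lemma edgeForm_of_rows (hs : ∀ e, Real.sin (ℓ e * ω) ≠ 0) {z : V ⊕ E × Bool → ℝ}
    (hz : ∀ p, (secA ι τ VD ℓ ω *ᵥ z) (Sum.inr p) = 0) (hx : ∀ u ∈ VD, z (Sum.inl u) = 0) :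
    edgeForm ι τ ℓ ω (fun u => z (Sum.inl u)) =
      ∑ u, z (Sum.inl u) * (secA ι τ VD ℓ ω *ᵥ z) (Sum.inl u) := by
  rw [edgeForm_eq_sum_flux]
  refine Finset.sum_congr rfl fun u _ => ?_
  by_cases hu : u ∈ VD
  · simp [hx u hu]
  · rw [flux_eq_of_edge_rows hs hz hu]

lemma det_eq_zero_of_flux {x : V → ℝ} (hs : ∀ e, Real.sin (ℓ e * ω) ≠ 0)
    (hx : ∀ v ∈ VD, x v = 0) (hx0 : x ≠ 0) (hflux : ∀ v ∉ VD, vertexFlux ι τ ℓ ω x v = 0) :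
    (secA ι τ VD ℓ ω).det = 0 := by
  set z : V ⊕ E × Bool → ℝ := Sum.elim x fun p =>
    if p.2 then (Real.cos (ℓ p.1 * ω) * x (τ p.1) - x (ι p.1)) / Real.sin (ℓ p.1 * ω)
    else (Real.cos (ℓ p.1 * ω) * x (ι p.1) - x (τ p.1)) / Real.sin (ℓ p.1 * ω) with hz
  have hrow : ∀ p, (secA ι τ VD ℓ ω *ᵥ z) (Sum.inr p) = 0 := by
    rintro ⟨e, _ | _⟩
    · rw [secA_mulVec_inr_false]
      have := hs e
      simp only [hz, Sum.elim_inl, Sum.elim_inr]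
      simp only [Bool.false_eq_true, if_false]
      field_simp
      ring
    · rw [secA_mulVec_inr_true]
      have := hs e
      simp only [hz, Sum.elim_inl, Sum.elim_inr]
      simp only [Bool.false_eq_true, if_false, if_true]
      field_simp
      linear_combination x (ι e) * Real.sin_sq_add_cos_sq (ℓ e * ω)
  refine Matrix.exists_mulVec_eq_zero_iff.1 ⟨z, fun h => hx0 ?_, ?_⟩
  · exact funext fun u => congrFun h (Sum.inl u)
  · funext i
    rcases i with u | p
    · by_cases hu : u ∈ VD
      · rw [secA_mulVec_inl, if_pos hu]
        exact hx u hu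
      · rw [flux_eq_of_edge_rows hs hrow hu]
        exact hflux u hu
    · exact hrow p

lemma FormPos.of_nonneg (hs : ∀ e, Real.sin (ℓ e * ω) ≠ 0)
    (hnn : ∀ x : V → ℝ, (∀ v ∈ VD, x v = 0) → 0 ≤ edgeForm ι τ ℓ ω x)
    (hdet : (secA ι τ VD ℓ ω).det ≠ 0) : FormPos ι τ ℓ VD ω := fun x hx hx0 =>
  lt_of_le_of_ne (hnn x hx) fun h => hdet <|
    det_eq_zero_of_flux hs hx hx0 fun _ hv => vertexFlux_eq_zero hnn hx h.symm hv

end Secular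

/-- Below the first zero of the secular function the form is positive. -/
lemma formPos_of_det_ne_zero (hconn : IsConnectedGraph ι τ) (hℓ : ∀ e, 0 < ℓ e)
    (hVD : VD.Nonempty) {b : ℝ} (hπ : ∀ ω, ω < b → ∀ e, ℓ e * ω < Real.pi)
    (hdet : ∀ ω, 0 < ω → ω < b → (secA ι τ VD ℓ ω).det ≠ 0) {ω : ℝ} (h0 : 0 < ω) (hb : ω < b) :
    FormPos ι τ ℓ VD ω := by
  have hsub : Set.Ioo 0 b ⊆ interior {t | FormPos ι τ ℓ VD t} := by
    refine isPreconnected_Ioo.subset_of_closure_inter_subset isOpen_interior ?_ ?_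
    · have h1 := FormPos.eventually_zero (VD := VD) hconn hℓ hVD
      rw [eventually_nhdsWithin_iff, Metric.eventually_nhds_iff] at h1
      obtain ⟨ε, hε, h⟩ := h1
      refine ⟨min (ε / 2) (b / 2), ⟨by have := h0.trans hb; positivity, ?_⟩, ?_⟩
      · exact (min_le_right _ _).trans_lt (by linarith)
      · refine mem_interior.2 ⟨Set.Ioo 0 ε, fun t ht => h ?_ ht.1, isOpen_Ioo, ?_, ?_⟩
        · simpa [abs_of_pos ht.1] using ht.2
        · have := h0.trans hb
          positivity
        · exact (min_le_left _ _).trans_lt (by linarith)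
    · rintro t ⟨ht, ht0, htb⟩
      have hs e := (sin_pos_of_length hℓ ht0 (hπ t htb) e).ne'
      have hp : FormPos ι τ ℓ VD t := FormPos.of_nonneg hs
        (edgeForm_nonneg_of_mem_closure hs (fun u hu => interior_subset hu) ht) (hdet t ht0 htb)
      exact mem_interior_iff_mem_nhds.2 (hp.eventually hs)
  exact interior_subset (hsub ⟨h0, hb⟩)

/-- Perron-Frobenius: a nonnegative form is positive on vectors vanishing at an additional
interior vertex. -/
lemma formPos_insert (hconn : IsConnectedGraph ι τ) (hdeg : ∀ v ∈ VD, graphDegree ι τ v = 1)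
    {ω : ℝ} (hs : ∀ e, 0 < Real.sin (ℓ e * ω))
    (hnn : ∀ x : V → ℝ, (∀ v ∈ VD, x v = 0) → 0 ≤ edgeForm ι τ ℓ ω x) {v : V} (hv : v ∉ VD) :
    FormPos ι τ ℓ (insert v VD) ω := by
  intro x hx hx0
  by_contra! hneg
  have habs : ∀ u ∈ VD, |x| u = 0 := fun u hu => by simp [hx u (Set.mem_insert_of_mem _ hu)]
  have hq : edgeForm ι τ ℓ ω |x| = 0 :=
    le_antisymm ((edgeForm_abs_le hs x).trans hneg) (hnn _ habs)
  have hzero : |x| = 0 := by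
    refine hconn.eq_zero_of_spread hdeg (fun u hu hxu e => ?_) hv (by simp [hx v])
    have hfl := vertexFlux_eq_zero hnn habs hq hu
    have h1 : ∀ e, 0 ≤ |x (ι e)| / Real.sin (ℓ e * ω) := fun e =>
      div_nonneg (abs_nonneg _) (hs e).le
    have h2 : ∀ e, 0 ≤ |x (τ e)| / Real.sin (ℓ e * ω) := fun e =>
      div_nonneg (abs_nonneg _) (hs e).le
    have hfl' : ∑ e, ((if ι e = u then |x (τ e)| / Real.sin (ℓ e * ω) else 0) +
        (if τ e = u then |x (ι e)| / Real.sin (ℓ e * ω) else 0)) = 0 := by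
      refine neg_eq_zero.1 (Eq.trans ?_ hfl)
      rw [vertexFlux, ← Finset.sum_neg_distrib]
      refine Finset.sum_congr rfl fun e _ => ?_
      rw [neg_add]
      congr 1
      · split_ifs with h
        · rw [h, hxu]; simp [neg_div]
        · simp
      · split_ifs with h
        · rw [h, hxu]; simp [neg_div]
        · simp
    rw [Finset.sum_eq_zero_iff_of_nonneg fun e _ => by
      have := h1 e; have := h2 e; positivity] at hfl'
    have h3 := hfl' e (Finset.mem_univ e)
    have := h1 e
    have := h2 e
    have hs' := (hs e).ne'
    rw [add_eq_zero_iff_of_nonneg (by positivity) (by positivity)] at h3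
    exact ⟨fun h => by simpa [h, hs'] using h3.1, fun h => by simpa [h, hs'] using h3.2⟩
  exact hx0 (by simpa using hzero)

end Positivity

lemma exists_zero_of_mul_nonpos {f : ℝ → ℝ} {a b : ℝ} (hab : a ≤ b)
    (hf : ContinuousOn f (Set.Icc a b)) (h : f a * f b ≤ 0) : ∃ c ∈ Set.Icc a b, f c = 0 := by
  rcases mul_nonpos_iff.1 h with ⟨h1, h2⟩ | ⟨h1, h2⟩
  · exact intermediate_value_Icc' hab hf ⟨h2, h1⟩
  · exact intermediate_value_Icc hab hf ⟨h1, h2⟩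

lemma adjugate_self_ne_zero {n : Type} [Fintype n] [DecidableEq n] {A : Matrix n n ℝ} {i : n}
    (h : ∀ z : n → ℝ, z i = 0 → (∀ j, j ≠ i → (A *ᵥ z) j = 0) → z = 0) :
    A.adjugate i i ≠ 0 := by
  rw [Matrix.adjugate_apply]
  intro h0
  obtain ⟨z, hz0, hz⟩ := Matrix.exists_mulVec_eq_zero_iff.2 h0
  refine hz0 (h z ?_ fun j hj => ?_)
  · simpa [Matrix.mulVec] using congrFun hz i
  · simpa [Matrix.mulVec, Matrix.updateRow_ne hj] using congrFun hz j

lemma exists_mulVec_eq_det {n : Type} [Fintype n] [DecidableEq n] (A : Matrix n n ℝ) (i : n) :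
    ∃ z : n → ℝ, z i = A.adjugate i i ∧ (A *ᵥ z) i = A.det ∧ ∀ j, j ≠ i → (A *ᵥ z) j = 0 := by
  have h : ∀ j, (A *ᵥ A.adjugate.col i) j = (A.det • (1 : Matrix n n ℝ)) j i := fun j => by
    rw [← Matrix.mul_adjugate]
    rfl
  refine ⟨A.adjugate.col i, rfl, ?_, fun j hj => ?_⟩
  · simp [h]
  · simp [h, hj]

lemma continuous_secA [Finite V] [Finite E] (VD : Set V) : Continuous (secA ι τ VD ℓ) := by
  refine continuous_matrix fun i j => ?_
  rcases i with v | ⟨e, b⟩ <;> rcases j with u | ⟨f, b'⟩ <;>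
    simp only [secA, secMatrix, Matrix.of_apply] <;> split_ifs <;> fun_prop

section SignChange

variable [Fintype V] [Fintype E] {VD : Set V} {ω₀ : ℝ}

/-- If some vertex is not a Dirichlet vertex, every edge is shorter than half a wavelength at the
first zero. -/
lemma length_mul_lt_pi (hnl : ∀ e, ι e ≠ τ e) (hconn : IsConnectedGraph ι τ) (hℓ : ∀ e, 0 < ℓ e)
    (hVD : VD.Nonempty) (hdeg : ∀ v ∈ VD, graphDegree ι τ v = 1) (hω₀ : 0 < ω₀)
    (hmin : ∀ ω : ℝ, 0 < ω → ω < ω₀ → (secA ι τ VD ℓ ω).det ≠ 0) {v₀ : V} (hv₀ : v₀ ∉ VD) (e : E) :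
    ℓ e * ω₀ < Real.pi := by
  have : Nonempty E := ⟨e⟩
  obtain ⟨e₀, he₀⟩ := Finite.exists_max ℓ
  refine (mul_le_mul_of_nonneg_right (he₀ e) hω₀.le).trans_lt ?_
  by_contra! hle
  obtain ⟨v, hv, hve⟩ : ∃ v ∉ VD, ι e₀ = v ∨ τ e₀ = v := by
    by_contra! hcon
    have h1 : ι e₀ ∈ VD := by_contra fun h => (hcon _ h).1 rfl
    have h2 : τ e₀ ∈ VD := by_contra fun h => (hcon _ h).2 rfl
    rcases hconn.eq_ends hdeg h1 h2 v₀ with h | h <;> simp_all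
  set b := Real.pi / ℓ e₀ with hb
  have hb0 : 0 < b := div_pos Real.pi_pos (hℓ e₀)
  have hbω : b ≤ ω₀ := by rwa [hb, div_le_iff₀' (hℓ e₀)]
  have hbπ : ℓ e₀ * b = Real.pi := by
    have := (hℓ e₀).ne'
    rw [hb]; field_simp
  have hπ : ∀ ω, ω < b → ∀ e, ℓ e * ω < Real.pi := by
    intro ω hω e
    rcases le_or_gt ω 0 with h | h
    · exact (mul_nonpos_of_nonneg_of_nonpos (hℓ e).le h).trans_lt Real.pi_pos
    · calc ℓ e * ω ≤ ℓ e₀ * ω := mul_le_mul_of_nonneg_right (he₀ e) h.le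
        _ < ℓ e₀ * b := mul_lt_mul_of_pos_left hω (hℓ e₀)
        _ = Real.pi := hbπ
  set δ : V → ℝ := Pi.single v 1 with hδ
  have hδW : ∀ u ∈ VD, δ u = 0 := fun u hu => by
    rw [hδ, Pi.single_apply, if_neg]
    rintro rfl
    exact hv hu
  have hpos : ∀ ω, 0 < ω → ω < b → 0 < Real.sin (ℓ e₀ * ω) * edgeForm ι τ ℓ ω δ := by
    intro ω h0 h1
    refine mul_pos (sin_pos_of_length hℓ h0 (hπ ω h1) e₀) ?_
    refine formPos_of_det_ne_zero hconn hℓ hVD hπ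
      (fun t ht0 htb => hmin t ht0 (htb.trans_le hbω)) h0 h1 δ hδW fun h => ?_
    simpa [hδ] using congrFun h v
  have hδe : ∀ e, δ (ι e) * δ (τ e) = 0 := fun e => by
    simp only [hδ, Pi.single_apply]
    split_ifs with h1 h2 <;> simp
    exact hnl e (h1.trans h2.symm)
  have hlim : ∀ e, Tendsto (fun ω => Real.sin (ℓ e₀ * ω) * ((Real.cos (ℓ e * ω) *
      (δ (ι e) ^ 2 + δ (τ e) ^ 2) - 2 * δ (ι e) * δ (τ e)) / Real.sin (ℓ e * ω))) (𝓝[<] b)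
      (𝓝 (if ℓ e = ℓ e₀ then -(δ (ι e) ^ 2 + δ (τ e) ^ 2) else 0)) := by
    intro e
    split_ifs with h
    · have hev : (fun ω => Real.cos (ℓ e₀ * ω) * (δ (ι e) ^ 2 + δ (τ e) ^ 2)) =ᶠ[𝓝[<] b]
          (fun ω => Real.sin (ℓ e₀ * ω) * ((Real.cos (ℓ e * ω) *
            (δ (ι e) ^ 2 + δ (τ e) ^ 2) - 2 * δ (ι e) * δ (τ e)) / Real.sin (ℓ e * ω))) := by
        filter_upwards [Ioo_mem_nhdsLT hb0] with ω hω
        have hs := (sin_pos_of_length hℓ hω.1 (hπ ω hω.2) e₀).ne'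
        rw [h, mul_assoc 2, hδe]
        field_simp
        ring
      refine Tendsto.congr' hev ?_
      have hc : ContinuousAt (fun ω => Real.cos (ℓ e₀ * ω) * (δ (ι e) ^ 2 + δ (τ e) ^ 2)) b := by
        fun_prop
      have h1 := hc.tendsto
      simp only [hbπ, Real.cos_pi, neg_one_mul] at h1
      exact h1.mono_left nhdsWithin_le_nhds
    · have hlt : ℓ e < ℓ e₀ := lt_of_le_of_ne (he₀ e) h
      have hs : Real.sin (ℓ e * b) ≠ 0 := (Real.sin_pos_of_pos_of_lt_pi (mul_pos (hℓ e) hb0)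
        (by rw [← hbπ]; exact mul_lt_mul_of_pos_right hlt hb0)).ne'
      have hc : ContinuousAt (fun ω => Real.sin (ℓ e₀ * ω) * ((Real.cos (ℓ e * ω) *
          (δ (ι e) ^ 2 + δ (τ e) ^ 2) - 2 * δ (ι e) * δ (τ e)) / Real.sin (ℓ e * ω))) b :=
        ContinuousAt.mul (by fun_prop) (ContinuousAt.div (by fun_prop) (by fun_prop) hs)
      have h1 := hc.tendsto
      simp only [hbπ, Real.sin_pi, zero_mul] at h1
      exact h1.mono_left nhdsWithin_le_nhds
  have hsum := tendsto_finsetSum Finset.univ fun e _ => hlim e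
  have hge : 0 ≤ ∑ e, (if ℓ e = ℓ e₀ then -(δ (ι e) ^ 2 + δ (τ e) ^ 2) else 0) := by
    refine ge_of_tendsto hsum ?_
    filter_upwards [Ioo_mem_nhdsLT hb0] with ω hω
    rw [← Finset.mul_sum]
    exact (hpos ω hω.1 hω.2).le
  refine hge.not_gt <| Finset.sum_neg' (fun e _ => ?_) ⟨e₀, Finset.mem_univ _, ?_⟩
  · have : 0 ≤ δ (ι e) ^ 2 + δ (τ e) ^ 2 := by positivity
    split_ifs <;> linarith
  · rw [if_pos rfl, neg_lt_zero]
    rcases hve with h | h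
    · have : δ (ι e₀) = 1 := by simp [hδ, h]
      rw [this]; positivity
    · have : δ (τ e₀) = 1 := by simp [hδ, h]
      rw [this]; positivity

lemma exists_edgeForm_eq_det_mul_adjugate {ω : ℝ} (hs : ∀ e, Real.sin (ℓ e * ω) ≠ 0) {v : V}
    (hv : v ∉ VD) :
    ∃ w : V → ℝ, w v = (secA ι τ VD ℓ ω).adjugate (Sum.inl v) (Sum.inl v) ∧
      (∀ u ∈ VD, w u = 0) ∧ (∀ u, u ∉ insert v VD → vertexFlux ι τ ℓ ω w u = 0) ∧
      edgeForm ι τ ℓ ω w =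
        (secA ι τ VD ℓ ω).det * (secA ι τ VD ℓ ω).adjugate (Sum.inl v) (Sum.inl v) := by
  obtain ⟨z, hzv, hdet, hz⟩ := exists_mulVec_eq_det (secA ι τ VD ℓ ω) (Sum.inl v)
  have hrow : ∀ p, (secA ι τ VD ℓ ω *ᵥ z) (Sum.inr p) = 0 := fun p => hz _ (by simp)
  have hzD : ∀ u ∈ VD, z (Sum.inl u) = 0 := fun u hu => by
    have h := hz (Sum.inl u) fun h => hv (Sum.inl_injective h ▸ hu)
    rwa [secA_mulVec_inl, if_pos hu] at h
  refine ⟨fun u => z (Sum.inl u), hzv, hzD, fun u hu => ?_, ?_⟩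
  · rw [Set.mem_insert_iff, not_or] at hu
    rw [← flux_eq_of_edge_rows hs hrow hu.2]
    exact hz _ fun h => hu.1 (Sum.inl_injective h)
  · rw [edgeForm_of_rows (VD := VD) hs hrow hzD, Finset.sum_eq_single v]
    · rw [hdet, hzv, mul_comm]
    · intro u _ hu
      rw [hz _ fun h => hu (Sum.inl_injective h), mul_zero]
    · simp

lemma adjugate_ne_zero_of_formPos {ω : ℝ} (hs : ∀ e, Real.sin (ℓ e * ω) ≠ 0) {v : V}
    (h : FormPos ι τ ℓ (insert v VD) ω) :
    (secA ι τ VD ℓ ω).adjugate (Sum.inl v) (Sum.inl v) ≠ 0 := by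
  refine adjugate_self_ne_zero fun z hzv hz => ?_
  have hrow : ∀ p, (secA ι τ VD ℓ ω *ᵥ z) (Sum.inr p) = 0 := fun p => hz _ (by simp)
  have hVD : ∀ u ∈ insert v VD, z (Sum.inl u) = 0 := by
    intro u hu
    by_cases huv : u = v
    · rw [huv, hzv]
    · have huD : u ∈ VD := Set.mem_of_mem_insert_of_ne hu huv
      have h1 := hz (Sum.inl u) (by simpa using huv)
      rwa [secA_mulVec_inl, if_pos huD] at h1
  refine eq_zero_of_edge_rows hs hrow (by_contra fun hx0 => ?_)
  refine (h _ hVD hx0).ne' ?_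
  rw [edgeForm_of_rows (VD := VD) hs hrow fun u hu => hVD u (Set.mem_insert_of_mem _ hu)]
  refine Finset.sum_eq_zero fun u _ => ?_
  by_cases huv : u = v
  · rw [huv, hzv, zero_mul]
  · rw [hz _ (by simpa using huv), mul_zero]

lemma det_mul_adjugate_neg {ω : ℝ} (hs : ∀ e, Real.sin (ℓ e * ω) ≠ 0) {v : V} (hv : v ∉ VD)
    (h : FormPos ι τ ℓ (insert v VD) ω) {x : V → ℝ} (hx : ∀ u ∈ VD, x u = 0) (hxv : x v ≠ 0)
    (hneg : edgeForm ι τ ℓ ω x < 0) :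
    (secA ι τ VD ℓ ω).det * (secA ι τ VD ℓ ω).adjugate (Sum.inl v) (Sum.inl v) < 0 := by
  have hD := adjugate_ne_zero_of_formPos hs h
  obtain ⟨w, hwv, hwD, hflux, hform⟩ := exists_edgeForm_eq_det_mul_adjugate hs hv
  rw [← hform]
  rw [← hwv] at hD
  set c := w v / x v with hc
  have hc0 : c ≠ 0 := div_ne_zero hD hxv
  have hy : ∀ u ∈ insert v VD, (c • x - w) u = 0 := by
    rintro u (rfl | hu)
    · simp [hc, hxv]
    · simp [hx u hu, hwD u hu]
  have hsum : ∑ u, (c • x - w) u * vertexFlux ι τ ℓ ω w u = 0 := by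
    refine Finset.sum_eq_zero fun u _ => ?_
    by_cases hu : u ∈ insert v VD
    · rw [hy u hu, zero_mul]
    · rw [hflux u hu, mul_zero]
  have hadd := edgeForm_add (ι := ι) (τ := τ) (ℓ := ℓ) ω w (c • x - w)
  rw [hsum, add_sub_cancel, edgeForm_smul] at hadd
  have h1 := h.nonneg hy
  have h2 : c ^ 2 * edgeForm ι τ ℓ ω x < 0 := mul_neg_of_pos_of_neg (by positivity) hneg
  linarith

lemma mul_pos_of_ne_zero {D : ℝ → ℝ} (hD : Continuous D) {a b : ℝ} (hab : a ≤ b)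
    (h : ∀ c ∈ Set.Icc a b, D c ≠ 0) : 0 < D a * D b := by
  by_contra! hcon
  obtain ⟨c, hc, hc0⟩ := exists_zero_of_mul_nonpos hab hD.continuousOn hcon
  exact h c hc hc0

lemma sign_change_of_interior (hnl : ∀ e, ι e ≠ τ e) (hconn : IsConnectedGraph ι τ)
    (hℓ : ∀ e, 0 < ℓ e) (hVD : VD.Nonempty) (hdeg : ∀ v ∈ VD, graphDegree ι τ v = 1)
    (hω₀ : 0 < ω₀) (hzero : (secA ι τ VD ℓ ω₀).det = 0)
    (hmin : ∀ ω : ℝ, 0 < ω → ω < ω₀ → (secA ι τ VD ℓ ω).det ≠ 0) {v : V} (hv : v ∉ VD) :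
    ∀ᶠ t in 𝓝[>] (0 : ℝ),
      (secA ι τ VD ℓ (ω₀ - t)).det * (secA ι τ VD ℓ (ω₀ + t)).det < 0 := by
  have hπ₀ := length_mul_lt_pi hnl hconn hℓ hVD hdeg hω₀ hmin hv
  have hs₀ := sin_pos_of_length hℓ hω₀ hπ₀
  have hs₀' : ∀ e, Real.sin (ℓ e * ω₀) ≠ 0 := fun e => (hs₀ e).ne'
  have hleft : ∀ ω ∈ Set.Ioo 0 ω₀, FormPos ι τ ℓ VD ω := fun ω hω =>
    formPos_of_det_ne_zero hconn hℓ hVD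
      (fun t ht e => (mul_lt_mul_of_pos_left ht (hℓ e)).trans (hπ₀ e)) hmin hω.1 hω.2
  have hnn : ∀ x : V → ℝ, (∀ u ∈ VD, x u = 0) → 0 ≤ edgeForm ι τ ℓ ω₀ x :=
    edgeForm_nonneg_of_mem_closure hs₀' hleft <| by
      rw [closure_Ioo hω₀.ne]
      exact Set.right_mem_Icc.2 hω₀.le
  have hW := formPos_insert hconn hdeg hs₀ hnn hv
  obtain ⟨z, hz0, hz⟩ := Matrix.exists_mulVec_eq_zero_iff.2 hzero
  have hrow : ∀ p, (secA ι τ VD ℓ ω₀ *ᵥ z) (Sum.inr p) = 0 := fun p => congrFun hz _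
  set x : V → ℝ := fun u => z (Sum.inl u) with hxdef
  have hx0 : x ≠ 0 := fun h => hz0 (eq_zero_of_edge_rows hs₀' hrow h)
  have hxD : ∀ u ∈ VD, x u = 0 := fun u hu => by
    have h1 := congrFun hz (Sum.inl u)
    rwa [secA_mulVec_inl, if_pos hu] at h1
  have hqx : edgeForm ι τ ℓ ω₀ x = 0 := by
    rw [edgeForm_of_rows hs₀' hrow hxD]
    exact Finset.sum_eq_zero fun u _ => by rw [hz]; simp
  have hxv : x v ≠ 0 := fun h => by
    refine (hW x ?_ hx0).ne' hqx
    rintro u (rfl | hu)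
    exacts [h, hxD u hu]
  have hnear : ∀ᶠ ω in 𝓝 ω₀, 0 < ω ∧ (∀ e, ℓ e * ω < Real.pi) ∧
      FormPos ι τ ℓ (insert v VD) ω := by
    refine (lt_mem_nhds hω₀).and ((eventually_all.2 fun e => ?_).and (hW.eventually hs₀'))
    have : ContinuousAt (fun t : ℝ => ℓ e * t) ω₀ := by fun_prop
    exact this.eventually_lt_const (hπ₀ e)
  obtain ⟨ε, hε, hball⟩ := Metric.eventually_nhds_iff.1 hnear
  filter_upwards [Ioo_mem_nhdsGT hε] with t ht
  have hIcc : ∀ ω ∈ Set.Icc (ω₀ - t) (ω₀ + t), 0 < ω ∧ (∀ e, ℓ e * ω < Real.pi) ∧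
      FormPos ι τ ℓ (insert v VD) ω := fun ω hω => hball <| by
    rw [Real.dist_eq, abs_lt]
    constructor <;> linarith [hω.1, hω.2, ht.2]
  have hsI : ∀ ω ∈ Set.Icc (ω₀ - t) (ω₀ + t), ∀ e, Real.sin (ℓ e * ω) ≠ 0 := fun ω hω e =>
    (sin_pos_of_length hℓ (hIcc ω hω).1 (hIcc ω hω).2.1 e).ne'
  have hle : ω₀ - t ≤ ω₀ + t := by linarith [ht.1]
  have hl := Set.left_mem_Icc.2 hle
  have hr := Set.right_mem_Icc.2 hle
  have hDD := mul_pos_of_ne_zero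
    (D := fun ω => (secA ι τ VD ℓ ω).adjugate (Sum.inl v) (Sum.inl v))
    ((continuous_secA VD).matrix_adjugate.matrix_elem _ _) hle
    fun c hc => adjugate_ne_zero_of_formPos (hsI c hc) (hIcc c hc).2.2
  have h1 : 0 < (secA ι τ VD ℓ (ω₀ - t)).det *
      (secA ι τ VD ℓ (ω₀ - t)).adjugate (Sum.inl v) (Sum.inl v) := by
    have hp := hleft (ω₀ - t) ⟨(hIcc _ hl).1, by linarith [ht.1]⟩
    obtain ⟨w, hwv, hwD, -, hform⟩ := exists_edgeForm_eq_det_mul_adjugate (hsI _ hl) hv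
    rw [← hform]
    refine hp w hwD fun h => ?_
    refine adjugate_ne_zero_of_formPos (hsI _ hl) (hIcc _ hl).2.2 ?_
    rw [← hwv, h, Pi.zero_apply]
  have h2 : (secA ι τ VD ℓ (ω₀ + t)).det *
      (secA ι τ VD ℓ (ω₀ + t)).adjugate (Sum.inl v) (Sum.inl v) < 0 := by
    refine det_mul_adjugate_neg (hsI _ hr) hv (hIcc _ hr).2.2 hxD hxv ?_
    rw [← hqx]
    refine edgeForm_lt hℓ hω₀ (by linarith [ht.1]) (hIcc _ hr).2.1 ?_
    obtain ⟨e, he⟩ := hconn.exists_incident hVD hdeg v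
    exact ⟨e, he.imp (fun h => by rwa [h]) fun h => by rwa [h]⟩
  have h3 := mul_neg_of_pos_of_neg h1 h2
  by_contra! hcon
  have h4 := mul_nonneg hcon hDD.le
  linarith

/-- On a single edge with two Dirichlet ends the secular function is a nonvanishing multiple of
`sin (ℓ e * ω)`. -/
lemma sign_change_of_univ (hconn : IsConnectedGraph ι τ)
    (hℓ : ∀ e, 0 < ℓ e) (hVD : VD.Nonempty) (hdeg : ∀ v ∈ VD, graphDegree ι τ v = 1)
    (hzero : (secA ι τ VD ℓ ω₀).det = 0) (huniv : ∀ v, v ∈ VD) :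
    ∀ᶠ t in 𝓝[>] (0 : ℝ),
      (secA ι τ VD ℓ (ω₀ - t)).det * (secA ι τ VD ℓ (ω₀ + t)).det < 0 := by
  obtain ⟨d, hd⟩ := hVD
  obtain ⟨e, -⟩ := hconn.exists_incident ⟨d, hd⟩ hdeg d
  have huniq : ∀ e', e' = e := fun e' => by
    rcases hconn.eq_ends hdeg (huniv (ι e)) (huniv (τ e)) (ι e') with h | h
    · exact eq_of_graphDegree_eq_one (hdeg _ (huniv (ι e))) (Or.inl h) (Or.inl rfl)
    · exact eq_of_graphDegree_eq_one (hdeg _ (huniv (τ e))) (Or.inl h) (Or.inr rfl)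
  set D : ℝ → ℝ := fun ω => (secA ι τ VD ℓ ω).adjugate (Sum.inr (e, false)) (Sum.inr (e, false))
    with hDdef
  have hD : ∀ ω, D ω ≠ 0 := fun ω => by
    refine adjugate_self_ne_zero fun z hze hz => ?_
    have hzl : ∀ u, z (Sum.inl u) = 0 := fun u => by
      have h := hz (Sum.inl u) (by simp)
      rwa [secA_mulVec_inl, if_pos (huniv u)] at h
    funext i
    rcases i with u | ⟨e', _ | _⟩
    · exact hzl u
    · rw [huniq e', hze]; rfl
    · have h := hz (Sum.inr (e, true)) (by simp)
      rw [secA_mulVec_inr_true, hzl, hze] at h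
      rw [huniq e']
      simpa using h
  have hf : ∀ ω, (secA ι τ VD ℓ ω).det = Real.sin (ℓ e * ω) * D ω := fun ω => by
    obtain ⟨z, hze, hdet, hz⟩ := exists_mulVec_eq_det (secA ι τ VD ℓ ω) (Sum.inr (e, false))
    have hzl : ∀ u, z (Sum.inl u) = 0 := fun u => by
      have h := hz (Sum.inl u) (by simp)
      rwa [secA_mulVec_inl, if_pos (huniv u)] at h
    rw [← hdet, secA_mulVec_inr_false, hzl, hzl, hze]
    ring
  have hs₀ : Real.sin (ℓ e * ω₀) = 0 := by
    rw [hf] at hzero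
    exact (mul_eq_zero.1 hzero).resolve_right (hD ω₀)
  have hpos : 0 < Real.pi / ℓ e := div_pos Real.pi_pos (hℓ e)
  filter_upwards [Ioo_mem_nhdsGT hpos] with t ht
  have hDD := mul_pos_of_ne_zero (D := D)
    ((continuous_secA VD).matrix_adjugate.matrix_elem _ _)
    (by linarith [ht.1] : ω₀ - t ≤ ω₀ + t) fun c _ => hD c
  have hst : 0 < Real.sin (ℓ e * t) := Real.sin_pos_of_pos_of_lt_pi (mul_pos (hℓ e) ht.1) <| by
    have := ht.2
    rwa [lt_div_iff₀' (hℓ e)] at this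
  have hc₀ : Real.cos (ℓ e * ω₀) ^ 2 = 1 := by
    have := Real.sin_sq_add_cos_sq (ℓ e * ω₀)
    rw [hs₀] at this
    linarith
  have hprod : Real.sin (ℓ e * (ω₀ - t)) * Real.sin (ℓ e * (ω₀ + t)) =
      -Real.sin (ℓ e * t) ^ 2 := by
    rw [mul_sub, mul_add, Real.sin_sub, Real.sin_add, hs₀]
    linear_combination -Real.sin (ℓ e * t) ^ 2 * hc₀
  rw [hf, hf]
  have h5 : 0 < Real.sin (ℓ e * t) ^ 2 * (D (ω₀ - t) * D (ω₀ + t)) := by positivity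
  linear_combination h5 + (D (ω₀ - t) * D (ω₀ + t)) * hprod

end SignChange

lemma exists_recurrent_times [Finite E] (ℓ : E → ℝ) :
    ∃ T : ℕ → ℝ, Tendsto T atTop atTop ∧
      (∀ e, Tendsto (fun n => Real.cos (ℓ e * T n)) atTop (𝓝 1)) ∧
      ∀ e, Tendsto (fun n => Real.sin (ℓ e * T n)) atTop (𝓝 0) := by
  obtain ⟨φ, hφ, hlim⟩ :=
    (mapClusterPt_one_atTop_pow fun e => Circle.exp (ℓ e)).tendsto_subseq
  have hcoe : ∀ e, Tendsto (fun n => Complex.exp ((ℓ e * φ n : ℝ) * Complex.I)) atTop (𝓝 1) := by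
    intro e
    have hcont : Continuous fun z : Circle => (z : ℂ) := by fun_prop
    have h1 := (hcont.tendsto 1).comp ((tendsto_pi_nhds.1 hlim) e)
    rw [Circle.coe_one] at h1
    refine Tendsto.congr (fun n => ?_) h1
    simp only [Function.comp_apply, Pi.pow_apply, Circle.coe_pow, Circle.coe_exp]
    rw [← Complex.exp_nat_mul]
    push_cast
    ring_nf
  refine ⟨fun n => φ n, tendsto_natCast_atTop_atTop.comp hφ.tendsto_atTop, fun e => ?_, fun e => ?_⟩
  · have h := (Complex.continuous_re.tendsto _).comp (hcoe e)
    simpa only [Function.comp_def, Complex.exp_ofReal_mul_I_re, Complex.one_re] using h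
  · have h := (Complex.continuous_im.tendsto _).comp (hcoe e)
    simpa only [Function.comp_def, Complex.exp_ofReal_mul_I_im, Complex.one_im] using h

lemma tendsto_secMatrix {α : Type*} {l : Filter α} {VD : Set V} {c s : α → E → ℝ} {c₀ s₀ : E → ℝ}
    (hc : ∀ e, Tendsto (fun x => c x e) l (𝓝 (c₀ e)))
    (hs : ∀ e, Tendsto (fun x => s x e) l (𝓝 (s₀ e))) :
    Tendsto (fun x => secMatrix ι τ VD (c x) (s x)) l (𝓝 (secMatrix ι τ VD c₀ s₀)) := by
  refine tendsto_pi_nhds.2 fun i => tendsto_pi_nhds.2 fun j => ?_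
  rcases i with v | ⟨e, b⟩ <;> rcases j with u | ⟨f, b'⟩ <;>
    simp only [secMatrix, Matrix.of_apply] <;> split_ifs <;>
    first
      | exact tendsto_const_nhds
      | exact hs e
      | exact tendsto_const_nhds.add (hc e).neg
      | exact (hc e).add tendsto_const_nhds

lemma tendsto_perturbed {α : Type*} {l : Filter α} {VD : Set V} {a : ℝ}
    {P : ℝ → Matrix (V ⊕ E × Bool) (V ⊕ E × Bool) ℝ}
    (hP : ∀ i j, ∃ C : ℝ, ∀ ω ∈ Set.Ici a, |P ω i j| ≤ C) {T s : α → ℝ} {s₀ : ℝ}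
    (hT : Tendsto T l atTop) (hcos : ∀ e, Tendsto (fun x => Real.cos (ℓ e * T x)) l (𝓝 1))
    (hsin : ∀ e, Tendsto (fun x => Real.sin (ℓ e * T x)) l (𝓝 0)) (hs : Tendsto s l (𝓝 s₀)) :
    Tendsto (fun x => secA ι τ VD ℓ (T x + s x) + (T x + s x)⁻¹ • P (T x + s x)) l
      (𝓝 (secA ι τ VD ℓ s₀)) := by
  have hTs : Tendsto (fun x => T x + s x) l atTop := hT.atTop_add hs
  have hc' : ∀ e, Tendsto (fun x => Real.cos (ℓ e * s x)) l (𝓝 (Real.cos (ℓ e * s₀))) := fun e =>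
    (Real.continuous_cos.tendsto _).comp (hs.const_mul (ℓ e))
  have hs' : ∀ e, Tendsto (fun x => Real.sin (ℓ e * s x)) l (𝓝 (Real.sin (ℓ e * s₀))) := fun e =>
    (Real.continuous_sin.tendsto _).comp (hs.const_mul (ℓ e))
  have hA : Tendsto (fun x => secA ι τ VD ℓ (T x + s x)) l (𝓝 (secA ι τ VD ℓ s₀)) := by
    refine tendsto_secMatrix (fun e => ?_) fun e => ?_
    · have h := ((hcos e).mul (hc' e)).sub ((hsin e).mul (hs' e))
      simpa only [mul_add, Real.cos_add, one_mul, zero_mul, sub_zero] using h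
    · have h := ((hsin e).mul (hc' e)).add ((hcos e).mul (hs' e))
      simpa only [mul_add, Real.sin_add, one_mul, zero_mul, zero_add] using h
  have hB : Tendsto (fun x => (T x + s x)⁻¹ • P (T x + s x)) l (𝓝 0) := by
    refine tendsto_pi_nhds.2 fun i => tendsto_pi_nhds.2 fun j => ?_
    obtain ⟨C, hC⟩ := hP i j
    have h0 : Tendsto (fun x => (T x + s x)⁻¹ * C) l (𝓝 0) := by
      simpa using (tendsto_inv_atTop_zero.comp hTs).mul_const C
    refine squeeze_zero_norm' ?_ h0
    filter_upwards [hTs.eventually_ge_atTop a, hTs.eventually_gt_atTop 0] with x hx hx0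
    rw [Matrix.smul_apply, smul_eq_mul, norm_mul, norm_inv, Real.norm_of_nonneg hx0.le]
    exact mul_le_mul_of_nonneg_left (hC _ hx) (inv_pos.2 hx0).le
  simpa using hA.add hB

/-- A sign change of a secular function propagates to zeros of its decaying perturbations along
the recurrent times of the torus flow. -/
lemma exists_perturbed_zeros [Fintype V] [Fintype E] {VD : Set V} {ω₀ a : ℝ} (ha : 0 < a)
    {P : ℝ → Matrix (V ⊕ E × Bool) (V ⊕ E × Bool) ℝ}
    (hPcont : ∀ i j, ContinuousOn (fun ω => P ω i j) (Set.Ici a))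
    (hPbound : ∀ i j, ∃ C : ℝ, ∀ ω ∈ Set.Ici a, |P ω i j| ≤ C)
    (hsign : ∀ᶠ t in 𝓝[>] (0 : ℝ),
      (secA ι τ VD ℓ (ω₀ - t)).det * (secA ι τ VD ℓ (ω₀ + t)).det < 0) :
    ∃ ω : ℕ → ℝ, StrictMono ω ∧ (∀ n, a ≤ ω n) ∧
      Tendsto ω atTop atTop ∧
      (∀ n, (secA ι τ VD ℓ (ω n) + (ω n)⁻¹ • P (ω n)).det = 0) ∧
      Tendsto (fun n => secA ι τ VD ℓ (ω n) + (ω n)⁻¹ • P (ω n))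
        atTop (𝓝 (secA ι τ VD ℓ ω₀)) := by
  set B : ℝ → Matrix (V ⊕ E × Bool) (V ⊕ E × Bool) ℝ :=
    fun ω => secA ι τ VD ℓ ω + ω⁻¹ • P ω with hB
  obtain ⟨T, hT, hcos, hsin⟩ := exists_recurrent_times ℓ
  have hBcont : ContinuousOn B (Set.Ici a) := by
    refine (continuous_secA VD).continuousOn.add
      (continuousOn_pi.2 fun i => continuousOn_pi.2 fun j => ?_)
    exact (continuousOn_inv₀.mono fun x hx => (ha.trans_le hx).ne').mul (hPcont i j)
  have hdetcont : ContinuousOn (fun ω => (B ω).det) (Set.Ici a) :=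
    (continuous_id.matrix_det).comp_continuousOn hBcont
  have hpt : ∀ s, Tendsto (fun n => (B (T n + s)).det) atTop (𝓝 (secA ι τ VD ℓ s).det) := fun s =>
    (continuous_id.matrix_det.tendsto _).comp
      (tendsto_perturbed hPbound hT hcos hsin tendsto_const_nhds)
  have hunif : Tendsto (fun x : ℕ × ℝ => B (T x.1 + x.2)) (atTop ×ˢ 𝓝 ω₀)
      (𝓝 (secA ι τ VD ℓ ω₀)) :=
    tendsto_perturbed hPbound (hT.comp tendsto_fst) (fun e => (hcos e).comp tendsto_fst)
      (fun e => (hsin e).comp tendsto_fst) tendsto_snd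
  have hcluster : MapClusterPt (secA ι τ VD ℓ ω₀) (atTop ⊓ 𝓟 {ω | a ≤ ω ∧ (B ω).det = 0}) B := by
    refine mapClusterPt_iff_frequently.2 fun U hU => ?_
    rw [frequently_inf_principal, frequently_atTop]
    intro N
    obtain ⟨p, hp, q, hq, hpq⟩ := eventually_prod_iff.1 (hunif.eventually_mem hU)
    obtain ⟨ε, hε, hball⟩ := Metric.eventually_nhds_iff.1 hq
    obtain ⟨t, ht, htε⟩ := (hsign.and (Ioo_mem_nhdsGT hε)).exists
    have hprod := ((hpt (ω₀ - t)).mul (hpt (ω₀ + t))).eventually_lt_const ht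
    obtain ⟨n, hn, hpn, hTn⟩ :=
      (hprod.and (hp.and (hT.eventually_ge_atTop (max N a - (ω₀ - t))))).exists
    have hlow : max N a ≤ T n + (ω₀ - t) := by linarith
    obtain ⟨c, hc, hc0⟩ := exists_zero_of_mul_nonpos (by linarith [htε.1])
      (hdetcont.mono fun x hx => ((le_max_right N a).trans hlow).trans hx.1) hn.le
    have hca : max N a ≤ c := hlow.trans hc.1
    refine ⟨c, (le_max_left N a).trans hca, ⟨(le_max_right N a).trans hca, hc0⟩, ?_⟩
    have hcq : q (c - T n) := hball <| by
      rw [Real.dist_eq, abs_lt]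
      constructor <;> linarith [hc.1, hc.2, htε.2]
    simpa using hpq hpn hcq
  have : FirstCountableTopology (Matrix (V ⊕ E × Bool) (V ⊕ E × Bool) ℝ) :=
    inferInstanceAs (FirstCountableTopology (V ⊕ E × Bool → V ⊕ E × Bool → ℝ))
  obtain ⟨u, hBu, hu⟩ := hcluster.exists_seq_tendsto
  obtain ⟨hu1, hu2⟩ := tendsto_inf.1 hu
  obtain ⟨N, hN⟩ := eventually_atTop.1 (tendsto_principal.1 hu2)
  have hshift := tendsto_add_atTop_nat N
  obtain ⟨φ, hφ, hmono⟩ := strictMono_subseq_of_tendsto_atTop (hu1.comp hshift)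
  refine ⟨fun n => u (φ n + N), hmono, fun n => (hN _ (Nat.le_add_left _ _)).1,
    (hu1.comp hshift).comp hφ.tendsto_atTop, fun n => (hN _ (Nat.le_add_left _ _)).2,
    (hBu.comp hshift).comp hφ.tendsto_atTop⟩

end SecularMatrix

/-- Perturbation lemma on connected graphs with a nonempty Dirichlet set (all Dirichlet
vertices of degree one): if `ω₀` is the smallest positive zero of the secular function and
`P_ω` is a matrix-valued perturbation, entrywise smooth on `[a, ∞)` with all derivatives
bounded there, then the perturbed secular matrices `B_ω = A_ω(G, V_D) + ω⁻¹ P_ω` admit a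
strictly increasing sequence `ω_n → ∞` in `[a, ∞)` of zeros of `det B_ω` along which
`B_{ω_n} → A_{ω₀}(G, V_D)`. -/
theorem perturbed_secular_zeros_dirichlet {V E : Type} [Fintype V] [Fintype E]
    (ι τ : E → V) (hnl : ∀ e, ι e ≠ τ e)
    (hconn : IsConnectedGraph ι τ)
    (ℓ : E → ℝ) (hℓ : ∀ e, 0 < ℓ e)
    (VD : Set V) (hVD : VD.Nonempty)
    (hdeg : ∀ v ∈ VD, graphDegree ι τ v = 1)
    (ω₀ : ℝ) (hω₀ : 0 < ω₀)
    (hzero : (secA ι τ VD ℓ ω₀).det = 0)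
    (hmin : ∀ ω : ℝ, 0 < ω → ω < ω₀ → (secA ι τ VD ℓ ω).det ≠ 0)
    (a : ℝ) (ha : 0 < a)
    (P : ℝ → Matrix (V ⊕ E × Bool) (V ⊕ E × Bool) ℝ)
    (hPsmooth : ∀ i j, ∀ m : ℕ, ContDiffOn ℝ m (fun ω => P ω i j) (Set.Ici a))
    (hPbound : ∀ i j, ∀ m : ℕ, ∃ C : ℝ, ∀ ω ∈ Set.Ici a,
      |iteratedDerivWithin m (fun ω => P ω i j) (Set.Ici a) ω| ≤ C) :
    ∃ ω : ℕ → ℝ, StrictMono ω ∧ (∀ n, a ≤ ω n) ∧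
      Tendsto ω atTop atTop ∧
      (∀ n, (secA ι τ VD ℓ (ω n) + (ω n)⁻¹ • P (ω n)).det = 0) ∧
      Tendsto (fun n => secA ι τ VD ℓ (ω n) + (ω n)⁻¹ • P (ω n))
        atTop (nhds (secA ι τ VD ℓ ω₀)) := by
  refine exists_perturbed_zeros ha (fun i j => (hPsmooth i j 0).continuousOn)
    (fun i j => by simpa only [iteratedDerivWithin_zero] using hPbound i j 0) ?_
  by_cases h : ∃ v, v ∉ VD
  · obtain ⟨v, hv⟩ := h
    exact sign_change_of_interior hnl hconn hℓ hVD hdeg hω₀ hzero hmin hv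
  · push Not at h
    exact sign_change_of_univ hconn hℓ hVD hdeg hzero h
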